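/- The quintuple nested sum over quintuples of distinct odd positive integers satisfies ∑_{r=4}^{∞} ∑_{q=3}^{r-1} ∑_{p=2}^{q-1} ∑_{m=1}^{p-1} ∑_{k=0}^{m-1} 1/((2k+1)²·(2m+1)²·(2p+1)²·(2q+1)²·(2r+1)²) = (1/10!)·(π/2)¹⁰, where k < m < p < q < r range over nonnegative integers. -/

import Mathlib

open Real

/-- The elementary symmetric polynomial `e_j (a 0, …, a (n - 1))`, as a nested sum. -/
def nestedSum (a : ℕ → ℝ) : ℕ → ℕ → ℝ
  | 0, _ => 1
  | j + 1, n => ∑ i ∈ Finset.range n, a i * nestedSum a j i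

lemma nestedSum_zero (a : ℕ → ℝ) (n : ℕ) : nestedSum a 0 n = 1 := by
  simp only [nestedSum]

lemma nestedSum_succ (a : ℕ → ℝ) (j n : ℕ) :
    nestedSum a (j + 1) n = ∑ i ∈ Finset.range n, a i * nestedSum a j i := by
  simp only [nestedSum]

lemma nestedSum_nonneg {a : ℕ → ℝ} (ha : ∀ i, 0 ≤ a i) (j n : ℕ) : 0 ≤ nestedSum a j n := by
  induction j generalizing n with
  | zero => simp [nestedSum_zero]
  | succ j ih =>
    rw [nestedSum_succ]
    exact Finset.sum_nonneg fun i _ => mul_nonneg (ha i) (ih i)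

lemma nestedSum_one_eq_powerSum (a : ℕ → ℝ) (n : ℕ) :
    nestedSum a 1 n = ∑ i ∈ Finset.range n, a i ^ 1 := by
  simp [nestedSum_succ a 0, nestedSum_zero]

lemma nestedSum_two_eq_powerSum (a : ℕ → ℝ) (n : ℕ) :
    nestedSum a 2 n =
      ((∑ i ∈ Finset.range n, a i ^ 1) ^ 2 - ∑ i ∈ Finset.range n, a i ^ 2) / 2 := by
  rw [nestedSum_succ a 1]
  induction n with
  | zero => simp
  | succ n ih =>
    rw [Finset.sum_range_succ, ih, nestedSum_one_eq_powerSum]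
    simp only [Finset.sum_range_succ]
    ring

lemma nestedSum_three_eq_powerSum (a : ℕ → ℝ) (n : ℕ) :
    nestedSum a 3 n =
      ((∑ i ∈ Finset.range n, a i ^ 1) ^ 3
        - 3 * (∑ i ∈ Finset.range n, a i ^ 1) * (∑ i ∈ Finset.range n, a i ^ 2)
        + 2 * ∑ i ∈ Finset.range n, a i ^ 3) / 6 := by
  rw [nestedSum_succ a 2]
  induction n with
  | zero => simp
  | succ n ih =>
    rw [Finset.sum_range_succ, ih, nestedSum_two_eq_powerSum]
    simp only [Finset.sum_range_succ]
    ring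

lemma nestedSum_four_eq_powerSum (a : ℕ → ℝ) (n : ℕ) :
    nestedSum a 4 n =
      ((∑ i ∈ Finset.range n, a i ^ 1) ^ 4
        - 6 * (∑ i ∈ Finset.range n, a i ^ 1) ^ 2 * (∑ i ∈ Finset.range n, a i ^ 2)
        + 3 * (∑ i ∈ Finset.range n, a i ^ 2) ^ 2
        + 8 * (∑ i ∈ Finset.range n, a i ^ 1) * (∑ i ∈ Finset.range n, a i ^ 3)
        - 6 * ∑ i ∈ Finset.range n, a i ^ 4) / 24 := by
  rw [nestedSum_succ a 3]
  induction n with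
  | zero => simp
  | succ n ih =>
    rw [Finset.sum_range_succ, ih, nestedSum_three_eq_powerSum]
    simp only [Finset.sum_range_succ]
    ring

lemma nestedSum_five_eq_powerSum (a : ℕ → ℝ) (n : ℕ) :
    nestedSum a 5 n =
      ((∑ i ∈ Finset.range n, a i ^ 1) ^ 5
        - 10 * (∑ i ∈ Finset.range n, a i ^ 1) ^ 3 * (∑ i ∈ Finset.range n, a i ^ 2)
        + 15 * (∑ i ∈ Finset.range n, a i ^ 1) * (∑ i ∈ Finset.range n, a i ^ 2) ^ 2
        + 20 * (∑ i ∈ Finset.range n, a i ^ 1) ^ 2 * (∑ i ∈ Finset.range n, a i ^ 3)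
        - 20 * (∑ i ∈ Finset.range n, a i ^ 2) * (∑ i ∈ Finset.range n, a i ^ 3)
        - 30 * (∑ i ∈ Finset.range n, a i ^ 1) * (∑ i ∈ Finset.range n, a i ^ 4)
        + 24 * ∑ i ∈ Finset.range n, a i ^ 5) / 120 := by
  rw [nestedSum_succ a 4]
  induction n with
  | zero => simp
  | succ n ih =>
    rw [Finset.sum_range_succ, ih, nestedSum_four_eq_powerSum]
    simp only [Finset.sum_range_succ]
    ring

lemma hasSum_odd_reciprocal_sq_pow {k : ℕ} {c : ℝ}
    (h : HasSum (fun n : ℕ => 1 / (n : ℝ) ^ (2 * k)) c) :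
    HasSum (fun n : ℕ => (1 / (2 * (n : ℝ) + 1) ^ 2) ^ k) ((1 - 1 / 4 ^ k) * c) := by
  have heven : HasSum (fun n : ℕ => 1 / ((2 * n : ℕ) : ℝ) ^ (2 * k)) (1 / 4 ^ k * c) := by
    convert! h.mul_left (1 / 4 ^ k : ℝ) using 2 with n
    rw [Nat.cast_mul, mul_pow, pow_mul (((2 : ℕ) : ℝ)) 2 k]
    norm_num [mul_comm]
  have hodd : Summable (fun n : ℕ => 1 / ((2 * n + 1 : ℕ) : ℝ) ^ (2 * k)) :=
    h.summable.comp_injective (i := fun n : ℕ => 2 * n + 1) fun m n hmn => by simpa using hmn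
  have hsum := h.unique
    (HasSum.even_add_odd (f := fun n : ℕ => 1 / (n : ℝ) ^ (2 * k)) heven hodd.hasSum)
  convert hodd.hasSum using 1
  · ext n
    push_cast
    rw [div_pow, one_pow, pow_mul]
  · linarith

lemma bernoulli'_five : bernoulli' 5 = 0 :=
  bernoulli'_eq_zero_of_odd (by decide) (by decide)

lemma bernoulli'_six : bernoulli' 6 = 1 / 42 := by
  rw [bernoulli'_def]
  norm_num [Finset.sum_range_succ, Nat.choose, bernoulli'_five]

lemma bernoulli'_seven : bernoulli' 7 = 0 :=
  bernoulli'_eq_zero_of_odd (by decide) (by decide)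

lemma bernoulli'_eight : bernoulli' 8 = -1 / 30 := by
  rw [bernoulli'_def]
  norm_num [Finset.sum_range_succ, Nat.choose, bernoulli'_five, bernoulli'_six, bernoulli'_seven]

lemma bernoulli'_nine : bernoulli' 9 = 0 :=
  bernoulli'_eq_zero_of_odd (by decide) (by decide)

lemma bernoulli'_ten : bernoulli' 10 = 5 / 66 := by
  rw [bernoulli'_def]
  norm_num [Finset.sum_range_succ, Nat.choose, bernoulli'_five, bernoulli'_six, bernoulli'_seven,
    bernoulli'_eight, bernoulli'_nine]

lemma hasSum_zeta_six : HasSum (fun n : ℕ => 1 / (n : ℝ) ^ (2 * 3)) (π ^ 6 / 945) := by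
  convert hasSum_zeta_nat three_ne_zero using 1
  norm_num [bernoulli_eq_bernoulli'_of_ne_one, bernoulli'_six, Nat.factorial]
  ring

lemma hasSum_zeta_eight : HasSum (fun n : ℕ => 1 / (n : ℝ) ^ (2 * 4)) (π ^ 8 / 9450) := by
  convert hasSum_zeta_nat four_ne_zero using 1
  norm_num [bernoulli_eq_bernoulli'_of_ne_one, bernoulli'_eight, Nat.factorial]
  ring

lemma hasSum_zeta_ten : HasSum (fun n : ℕ => 1 / (n : ℝ) ^ (2 * 5)) (π ^ 10 / 93555) := by
  convert hasSum_zeta_nat (k := 5) (by decide) using 1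
  norm_num [bernoulli_eq_bernoulli'_of_ne_one, bernoulli'_ten, Nat.factorial]
  ring

theorem quintuple_nested_odd_reciprocal_squares_sum :
    (∑' r : ℕ, ∑ q ∈ Finset.range r, ∑ p ∈ Finset.range q, ∑ m ∈ Finset.range p,
      ∑ k ∈ Finset.range m,
      (1 : ℝ) / ((2 * (k : ℝ) + 1) ^ 2 * (2 * (m : ℝ) + 1) ^ 2 *
        (2 * (p : ℝ) + 1) ^ 2 * (2 * (q : ℝ) + 1) ^ 2 * (2 * (r : ℝ) + 1) ^ 2))
      = (1 / (Nat.factorial 10)) * (π / 2) ^ 10 := by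
  set a : ℕ → ℝ := fun n => 1 / (2 * (n : ℝ) + 1) ^ 2 with ha_def
  have ha : ∀ i, 0 ≤ a i := fun i => by positivity
  have hterm : ∀ r : ℕ, (∑ q ∈ Finset.range r, ∑ p ∈ Finset.range q, ∑ m ∈ Finset.range p,
      ∑ k ∈ Finset.range m,
      (1 : ℝ) / ((2 * (k : ℝ) + 1) ^ 2 * (2 * (m : ℝ) + 1) ^ 2 *
        (2 * (p : ℝ) + 1) ^ 2 * (2 * (q : ℝ) + 1) ^ 2 * (2 * (r : ℝ) + 1) ^ 2))
      = a r * nestedSum a 4 r := fun r => by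
    simp only [nestedSum, Finset.mul_sum, ha_def]
    refine Finset.sum_congr rfl fun q _ => Finset.sum_congr rfl fun p _ =>
      Finset.sum_congr rfl fun m _ => Finset.sum_congr rfl fun k _ => ?_
    simp only [one_div, mul_inv, mul_one]
    ring
  simp only [hterm]
  refine HasSum.tsum_eq ((hasSum_iff_tendsto_nat_of_nonneg
    (fun i => mul_nonneg (ha i) (nestedSum_nonneg ha 4 i)) _).2 ?_)
  simp only [← nestedSum_succ, Nat.reduceAdd, nestedSum_five_eq_powerSum]
  have h1 := (hasSum_odd_reciprocal_sq_pow (k := 1) hasSum_zeta_two).tendsto_sum_nat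
  have h2 := (hasSum_odd_reciprocal_sq_pow (k := 2) hasSum_zeta_four).tendsto_sum_nat
  have h3 := (hasSum_odd_reciprocal_sq_pow hasSum_zeta_six).tendsto_sum_nat
  have h4 := (hasSum_odd_reciprocal_sq_pow hasSum_zeta_eight).tendsto_sum_nat
  have h5 := (hasSum_odd_reciprocal_sq_pow hasSum_zeta_ten).tendsto_sum_nat
  convert (((((((h1.pow 5).sub (((h1.pow 3).const_mul 10).mul h2)).add
    ((h1.const_mul 15).mul (h2.pow 2))).add (((h1.pow 2).const_mul 20).mul h3)).sub
    ((h2.const_mul 20).mul h3)).sub ((h1.const_mul 30).mul h4)).add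
    (h5.const_mul 24)).div_const 120 using 2
  norm_num [Nat.factorial]
  ring
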